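/- arXiv:1609.00655 — 2 statements merged into one kernel-verified Lean document; each statement's English description precedes it below -/
import Mathlib

section
/- Let A ∈ ℝ^{n×n}, B ∈ ℝ^{n×p}, and suppose the pair (A, B) is controllable. Let Γᵀ ∈ ℝ^{k×N} have full row rank k. Then the pair (I_k ⊗ A, Γᵀ ⊗ B), with state dimension kn, is controllable. -/
open Matrix
open scoped Kronecker

/-- A pair `(F, G)` is controllable if the controllability matrix
`[G, FG, F²G, …, F^{m−1}G]` has full rank `m` (where `m` is the state dimension). -/
def Controllable {m q : Type*} [Fintype m] [Fintype q] [DecidableEq m]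
    (F : Matrix m m ℝ) (G : Matrix m q ℝ) : Prop :=
  (Matrix.of fun (i : m) (kj : Fin (Fintype.card m) × q) =>
    (F ^ (kj.1 : ℕ) * G) i kj.2).rank = Fintype.card m

/-- A matrix over a field has full row rank iff its left kernel is trivial. -/
theorem rank_eq_card_iff_vecMul {K m n : Type*} [Field K] [Fintype m] [Fintype n]
    (M : Matrix m n K) :
    M.rank = Fintype.card m ↔ ∀ v : m → K, v ᵥ* M = 0 → v = 0 := by
  rw [M.rank_eq_finrank_span_row, eq_comm, ← Set.finrank,
    ← linearIndependent_iff_card_eq_finrank_span, ← Matrix.vecMul_injective_iff]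
  exact injective_iff_map_eq_zero M.vecMulLinear

/-- Dual form of controllability: no nonzero row vector annihilates every `F ^ j * G`. -/
theorem controllable_iff_vecMul {m q : Type*} [Fintype m] [Fintype q] [DecidableEq m]
    (F : Matrix m m ℝ) (G : Matrix m q ℝ) :
    Controllable F G ↔
      ∀ v : m → ℝ, (∀ j < Fintype.card m, v ᵥ* (F ^ j * G) = 0) → v = 0 := by
  rw [Controllable, rank_eq_card_iff_vecMul]
  refine forall_congr' fun v => imp_congr_left ⟨fun h j hj => ?_, fun h => ?_⟩
  · ext x
    exact congrFun h (⟨j, hj⟩, x)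
  · ext ⟨j, x⟩
    exact congrFun (h j j.2) x

theorem one_kronecker_pow {m n R : Type*} [Fintype m] [DecidableEq m] [Fintype n]
    [DecidableEq n] [CommSemiring R] (A : Matrix n n R) (j : ℕ) :
    ((1 : Matrix m m R) ⊗ₖ A) ^ j = 1 ⊗ₖ (A ^ j) := by
  induction j with
  | zero => simp
  | succ j ih => rw [pow_succ, ih, ← Matrix.mul_kronecker_mul, one_mul, pow_succ]

/-- If `(A, B)` is controllable and `Γᵀ ∈ ℝ^{k×N}` has full row rank `k`, then
`(I_k ⊗ A, Γᵀ ⊗ B)` is controllable. -/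
theorem kron_pair_controllable (n p N k : ℕ)
    (A : Matrix (Fin n) (Fin n) ℝ) (B : Matrix (Fin n) (Fin p) ℝ)
    (hAB : Controllable A B)
    (Γ : Matrix (Fin N) (Fin k) ℝ) (hΓ : Γᵀ.rank = k) :
    Controllable ((1 : Matrix (Fin k) (Fin k) ℝ) ⊗ₖ A) (Γᵀ ⊗ₖ B) := by
  rw [controllable_iff_vecMul] at hAB ⊢
  have hΓ' := (rank_eq_card_iff_vecMul Γᵀ).1 (by simpa using hΓ)
  intro v hv
  suffices h : ∀ a, (fun i => v (a, i)) = 0 from funext fun ⟨a, i⟩ => congrFun (h a) i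
  refine fun a => hAB _ fun j hj => funext fun x => ?_
  refine congrFun (hΓ' (fun a => ((fun i => v (a, i)) ᵥ* (A ^ j * B)) x) ?_) a
  have hlt : j < Fintype.card (Fin k × Fin n) := by
    simp only [Fintype.card_prod, Fintype.card_fin] at hj ⊢
    exact hj.trans_le (Nat.le_mul_of_pos_left n a.pos)
  ext l
  have h := congrFun (hv j hlt) (l, x)
  rw [one_kronecker_pow, ← Matrix.mul_kronecker_mul, Matrix.one_mul] at h
  simp only [Matrix.vecMul, dotProduct, Fintype.sum_prod_type, Matrix.kronecker_apply,
    Pi.zero_apply, Finset.sum_mul] at h ⊢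
  rw [← h]
  exact Finset.sum_congr rfl fun _ _ => Finset.sum_congr rfl fun _ _ => by ring
end

section
/- Let A ∈ ℝ^{n×n}, B ∈ ℝ^{n×p}, Q ∈ ℝ^{n×n} symmetric positive semidefinite, R ∈ ℝ^{p×p} symmetric positive definite, and consider the algebraic Riccati equation X B R⁻¹ Bᵀ X − XA − AᵀX − Q = 0. Suppose the pair (A, B) is stabilizable. Then: (i) if X_s is a strong solution (a symmetric solution such that every complex eigenvalue of A − BR⁻¹BᵀX_s has nonpositive real part), then X_s is a maximal solution, i.e., X̃ ≤ X_s in the Loewner order for every symmetric solution X̃; and (ii) the algebraic Riccati equation has at most one strong solution. -/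
open Matrix

/-- `(A, B)` is stabilizable if some state feedback `F` places all complex eigenvalues of
`A + BF` in the open left half-plane. -/
def Stabilizable {n p : ℕ} (A : Matrix (Fin n) (Fin n) ℝ) (B : Matrix (Fin n) (Fin p) ℝ) :
    Prop :=
  ∃ F : Matrix (Fin p) (Fin n) ℝ,
    ∀ (μ : ℂ) (v : Fin n → ℂ), v ≠ 0 →
      ((A + B * F).map (Complex.ofReal)) *ᵥ v = μ • v → μ.re < 0

/-- `X` solves the algebraic Riccati equation `X B R⁻¹ Bᵀ X − XA − AᵀX − Q = 0`. -/
def SolvesARE {n p : ℕ} (A : Matrix (Fin n) (Fin n) ℝ) (B : Matrix (Fin n) (Fin p) ℝ)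
    (Q : Matrix (Fin n) (Fin n) ℝ) (R : Matrix (Fin p) (Fin p) ℝ)
    (X : Matrix (Fin n) (Fin n) ℝ) : Prop :=
  X * B * R⁻¹ * Bᵀ * X - X * A - Aᵀ * X - Q = 0

/-- `X` is a strong solution of the ARE: a symmetric solution such that every complex
eigenvalue of `A − BR⁻¹BᵀX` has nonpositive real part. -/
def StrongSolution {n p : ℕ} (A : Matrix (Fin n) (Fin n) ℝ) (B : Matrix (Fin n) (Fin p) ℝ)
    (Q : Matrix (Fin n) (Fin n) ℝ) (R : Matrix (Fin p) (Fin p) ℝ)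
    (X : Matrix (Fin n) (Fin n) ℝ) : Prop :=
  Xᵀ = X ∧ SolvesARE A B Q R X ∧
    ∀ (μ : ℂ) (v : Fin n → ℂ), v ≠ 0 →
      ((A - B * R⁻¹ * Bᵀ * X).map (Complex.ofReal)) *ᵥ v = μ • v → μ.re ≤ 0

open scoped ComplexConjugate in
/-- A Hermitian form that decreases along a linear flow without growing modes is positive
semidefinite, provided that the modes along which it is conserved are stabilizable (in the dual
Hautus form, relative to the set `U` of input directions). -/
theorem hermitian_form_nonneg_of_dissipative {V : Type*} [AddCommGroup V] [Module ℂ V]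
    [FiniteDimensional ℂ V] (h : V →ₗ⋆[ℂ] V →ₗ[ℂ] ℂ) (M : V →ₗ[ℂ] V) (U : Set V)
    (hherm : ∀ x y, h y x = conj (h x y))
    (hdiss : ∀ x, (h x (M x)).re ≤ 0)
    (hcons : ∀ x, (h x (M x)).re = 0 →
      (∀ u ∈ U, h x u = 0) ∧ ∀ y, h x (M y) + h (M x) y = 0)
    (hM : ∀ (μ : ℂ) (x : V), x ≠ 0 → M x = μ • x → μ.re ≤ 0)
    (hU : ∀ (f : V →ₗ[ℂ] ℂ) (μ : ℂ), 0 ≤ μ.re → (∀ x, f (M x) = μ * f x) →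
      (∀ u ∈ U, f u = 0) → f = 0) (x : V) :
    0 ≤ (h x x).re := by
  induction hd : Module.finrank ℂ V using Nat.strong_induction_on generalizing V with
  | _ d ih =>
  rcases subsingleton_or_nontrivial V with hV | hV
  · simp [Subsingleton.elim x 0]
  obtain ⟨lam, hlam⟩ := Module.End.exists_eigenvalue M
  obtain ⟨v, hv⟩ := hlam.exists_hasEigenvector
  have hMv : M v = lam • v := hv.apply_eq_smul
  have hv0 : v ≠ 0 := hv.2
  have hlam_re : lam.re ≤ 0 := hM lam v hv0 hMv
  have hvv_im : (h v v).im = 0 := Complex.conj_eq_iff_im.1 (hherm v v).symm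
  have hvMv : (h v (M v)).re = lam.re * (h v v).re := by
    simp [hMv, Complex.mul_re, hvv_im]
  have hvMv_nonpos : lam.re * (h v v).re ≤ 0 := hvMv ▸ hdiss v
  obtain ⟨g, hgv, hg, hvv⟩ : ∃ g : V →ₗ[ℂ] ℂ, g v = 1 ∧ (∀ y, h v y = h v v * g y) ∧
      0 ≤ (h v v).re := by
    by_cases hzero : lam.re * (h v v).re = 0
    · obtain ⟨h1, h2⟩ := hcons v (hvMv.trans hzero)
      have hf : h v = 0 := by
        refine hU (h v) (-conj lam) (by simpa using hlam_re) (fun y => ?_) h1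
        have := h2 y
        simp only [hMv, map_smulₛₗ, LinearMap.smul_apply, smul_eq_mul] at this
        linear_combination this
      obtain ⟨g, hg⟩ : ∃ g : Module.Dual ℂ V, g v ≠ 0 := by
        by_contra! hcon
        exact hv0 ((Module.forall_dual_apply_eq_zero_iff ℂ v).1 hcon)
      exact ⟨(g v)⁻¹ • g, by simp [hg], by simp [hf], by simp [hf]⟩
    · have hre : (h v v).re ≠ 0 := right_ne_zero_of_mul hzero
      have hne : h v v ≠ 0 := fun hc => hre (by simp [hc])
      refine ⟨(h v v)⁻¹ • h v, by simp [hne], fun y => by simp [hne], ?_⟩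
      by_contra! hneg
      exact hzero (le_antisymm hvMv_nonpos (mul_nonneg_of_nonpos_of_nonpos hlam_re hneg.le))
  let W : Submodule ℂ V := LinearMap.ker g
  let P : V →ₗ[ℂ] W := (LinearMap.id - g.smulRight v).codRestrict W
    (fun y => by simp [W, hgv])
  have hP : ∀ y, (P y : V) = y - g y • v := fun y => rfl
  have hWv : ∀ w : W, h w v = 0 := fun w => by
    have : g w = 0 := w.2
    rw [hherm v w, hg, this]; simp
  have hvW : ∀ w : W, h v w = 0 := fun w => by
    have : g w = 0 := w.2
    rw [hg, this]; simp
  have hWP : ∀ (w : W) y, h w (P y) = h w y := fun w y => by simp [hP, hWv]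
  have hPW : ∀ (w : W) y, h (P y) w = h y w := fun w y => by simp [hP, hvW]
  have hPv : P v = 0 := Subtype.ext (by simp [hP, hgv])
  have hPM : ∀ y, P (M (P y)) = P (M y) := fun y => by simp [hP, hMv, hPv]
  have hlt : Module.finrank ℂ W < d := by
    rw [← hd]
    refine Submodule.finrank_lt (fun htop => ?_)
    have : v ∈ W := htop ▸ Submodule.mem_top
    have : g v = 0 := this
    simp [hgv] at this
  have hPx : 0 ≤ (h (P x) (P x)).re := by
    let hW : W →ₗ⋆[ℂ] W →ₗ[ℂ] ℂ := h.domRestrict₁₂ W W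
    have hhW : ∀ w z, hW w z = h w z := fun _ _ => rfl
    refine ih _ hlt hW (P ∘ₗ M ∘ₗ W.subtype) (P '' U)
      (fun w z => hherm w z) (fun w => ?_) (fun w hw => ?_) (fun μ w hw0 hw => ?_)
      (fun f μ hμ hf hfU => ?_) (P x) rfl
    · simpa [hhW, hWP] using hdiss w
    · obtain ⟨h1, h2⟩ := hcons w (by simpa [hhW, hWP] using hw)
      refine ⟨?_, fun z => by simpa [hhW, hWP, hPW] using h2 z⟩
      rintro _ ⟨u, hu, rfl⟩
      simpa [hhW, hWP] using h1 u hu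
    · by_cases hμ : μ = lam
      · exact hμ ▸ hlam_re
      have hμ' : μ - lam ≠ 0 := sub_ne_zero.2 hμ
      have hgw : g w = 0 := w.2
      have hMw : M w = μ • (w : V) + g (M w) • v := by
        have := congrArg (Subtype.val) hw
        simp only [LinearMap.comp_apply, hP, Submodule.subtype_apply, Submodule.coe_smul] at this
        rw [← this]; abel
      set c := g (M w)
      refine hM μ (w + (c / (μ - lam)) • v) (fun h0 => hw0 ?_) ?_
      · have : P (w + (c / (μ - lam)) • v) = w := Subtype.ext (by simp [hP, hgv, hgw])
        rw [← this, h0, map_zero]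
      · rw [map_add, hMw, map_smul, hMv]
        match_scalars
        · ring
        · field_simp
          ring
    · have hfP : f ∘ₗ P = 0 := hU (f ∘ₗ P) μ hμ
        (fun y => by simpa [hPM] using hf (P y)) (fun u hu => hfU _ ⟨u, hu, rfl⟩)
      ext w
      have hgw : g w = 0 := w.2
      have hw : P w = w := Subtype.ext (by simp [hP, hgw])
      simpa [hw] using LinearMap.congr_fun hfP w
  have hx : h x x = h (P x) (P x) + h v v * (conj (g x) * g x) := by
    have hxd : x = P x + g x • v := by rw [hP]; abel
    conv_lhs => rw [hxd]
    simp [hWv, hvW]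
    ring
  rw [hx, ← Complex.normSq_eq_conj_mul_self, Complex.add_re, Complex.re_mul_ofReal]
  exact add_nonneg hPx (mul_nonneg hvv (Complex.normSq_nonneg _))


namespace Matrix

variable {n p q : ℕ}

/-- Lyapunov-type criterion: a symmetric solution `D` of `D M + Mᵀ D = -Lᵀ L` is positive
semidefinite when `M` has no eigenvalue with positive real part and `(M, B)` is stabilizable for
some `B` such that `Bᵀ D` factors through `L`. -/
theorem posSemidef_of_lyapunov {D M : Matrix (Fin n) (Fin n) ℝ} {L : Matrix (Fin q) (Fin n) ℝ}
    {B : Matrix (Fin n) (Fin p) ℝ} {E : Matrix (Fin p) (Fin q) ℝ} (hD : Dᵀ = D)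
    (hlyap : D * M + Mᵀ * D = -(Lᵀ * L)) (hE : Bᵀ * D = E * L)
    (hM : ∀ (μ : ℂ) (v : Fin n → ℂ), v ≠ 0 → M.map Complex.ofReal *ᵥ v = μ • v → μ.re ≤ 0)
    (hstab : Stabilizable M B) : D.PosSemidef := by
  let c {k l : ℕ} (X : Matrix (Fin k) (Fin l) ℝ) : Matrix (Fin k) (Fin l) ℂ :=
    X.map Complex.ofReal
  have hmul {k l m : ℕ} (X : Matrix (Fin k) (Fin l) ℝ) (Y : Matrix (Fin l) (Fin m) ℝ) :
      c (X * Y) = c X * c Y := Matrix.map_mul (f := Complex.ofRealHom)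
  have hadd {k l : ℕ} (X Y : Matrix (Fin k) (Fin l) ℝ) : c (X + Y) = c X + c Y := by
    ext; simp [c]
  have hneg {k l : ℕ} (X : Matrix (Fin k) (Fin l) ℝ) : c (-X) = -c X := by
    ext; simp [c]
  have hstar {k l : ℕ} (X : Matrix (Fin k) (Fin l) ℝ) : (c X)ᴴ = c Xᵀ := by
    ext; simp [c]
  have hadj {k l : ℕ} (X : Matrix (Fin k) (Fin l) ℝ) (x : Fin k → ℂ) (y : Fin l → ℂ) :
      star x ⬝ᵥ c X *ᵥ y = star (c Xᵀ *ᵥ x) ⬝ᵥ y := by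
    rw [star_mulVec, hstar, transpose_transpose, dotProduct_mulVec]
  have hadj' {k l : ℕ} (X : Matrix (Fin k) (Fin l) ℝ) (x : Fin l → ℂ) (y : Fin k → ℂ) :
      star (c X *ᵥ x) ⬝ᵥ y = star x ⬝ᵥ c Xᵀ *ᵥ y := by
    rw [hadj, transpose_transpose]
  let h : (Fin n → ℂ) →ₗ⋆[ℂ] (Fin n → ℂ) →ₗ[ℂ] ℂ :=
    LinearMap.mk₂'ₛₗ (starRingEnd ℂ) (RingHom.id ℂ) (fun x y => star x ⬝ᵥ c D *ᵥ y)
      (fun x y z => by simp [add_dotProduct]) (fun a x y => by simp)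
      (fun x y z => by simp [mulVec_add, dotProduct_add]) (fun a x y => by simp [mulVec_smul])
  have hh : ∀ x y, h x y = star x ⬝ᵥ c D *ᵥ y := fun _ _ => rfl
  have hherm : ∀ x y, h y x = starRingEnd ℂ (h x y) := fun x y => by
    rw [hh, hh, hadj, hD, starRingEnd_apply, star_dotProduct]
  have hL : ∀ x y, h x (c M *ᵥ y) + h (c M *ᵥ x) y = -(star (c L *ᵥ x) ⬝ᵥ c L *ᵥ y) := by
    intro x y
    rw [hh, hh, hadj' M, hadj' L, ← dotProduct_add, mulVec_mulVec, mulVec_mulVec, mulVec_mulVec,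
      ← add_mulVec, ← hmul, ← hmul, ← hmul, ← hadd, hlyap, hneg, neg_mulVec, dotProduct_neg]
  have hre : ∀ x, 2 * (h x (c M *ᵥ x)).re = -(star (c L *ᵥ x) ⬝ᵥ c L *ᵥ x).re := by
    intro x
    have := congrArg Complex.re (hL x x)
    rw [hherm x (c M *ᵥ x), Complex.add_re, Complex.conj_re, Complex.neg_re] at this
    linarith
  have hnonneg : ∀ x, 0 ≤ (star (c L *ᵥ x) ⬝ᵥ c L *ᵥ x).re := fun x => by
    open scoped ComplexOrder in
    exact (Complex.nonneg_iff.1 (dotProduct_star_self_nonneg (c L *ᵥ x))).1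
  obtain ⟨F, hF⟩ := hstab
  refine PosSemidef.of_dotProduct_mulVec_nonneg (by simpa [IsSymm] using hD) (fun x => ?_)
  have hx := hermitian_form_nonneg_of_dissipative h (toLin' (c M)) (Set.range (c B).mulVec)
    hherm (fun y => ?_) (fun y hy => ?_) hM (fun f μ hμ hf hfB => ?_) (fun i => x i)
  · have hcast : h (fun i => x i) (fun i => x i) = ((x ⬝ᵥ D *ᵥ x : ℝ) : ℂ) := by
      simp [hh, c, dotProduct, mulVec]
    simpa [hcast] using hx
  · rw [toLin'_apply]
    linarith [hre y, hnonneg y]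
  · rw [toLin'_apply] at hy
    have hLy : c L *ᵥ y = 0 := by
      open scoped ComplexOrder in
      refine dotProduct_star_self_eq_zero.1 (Complex.ext (by simpa using by linarith [hre y]) ?_)
      exact (Complex.nonneg_iff.1 (dotProduct_star_self_nonneg (c L *ᵥ y))).2.symm
    refine ⟨?_, fun z => by rw [toLin'_apply, toLin'_apply, hL, hLy]; simp⟩
    rintro _ ⟨u, rfl⟩
    rw [hherm, hh, hadj' B, mulVec_mulVec, ← hmul, hE, hmul, ← mulVec_mulVec, hLy]
    simp
  · have hfK : ∀ y, f (c (M + B * F) *ᵥ y) = μ * f y := fun y => by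
      rw [hadd, hmul, add_mulVec, map_add, ← mulVec_mulVec, hfB _ ⟨_, rfl⟩, add_zero]
      exact hf y
    let T : (Fin n → ℂ) →ₗ[ℂ] (Fin n → ℂ) := toLin' (c (M + B * F)) - μ • LinearMap.id
    have hT : ∀ y, T y = c (M + B * F) *ᵥ y - μ • y := fun y => by simp [T]
    have hinj : Function.Injective T := by
      refine (injective_iff_map_eq_zero T).2 fun v hv => ?_
      by_contra hv0
      exact absurd (hF μ v hv0 (sub_eq_zero.1 ((hT v).symm.trans hv))) (not_lt.2 hμ)
    refine LinearMap.ext fun y => ?_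
    obtain ⟨z, rfl⟩ := LinearMap.injective_iff_surjective.1 hinj y
    rw [hT, map_sub, hfK, map_smul, smul_eq_mul, sub_self, LinearMap.zero_apply]

end Matrix

/-- The difference of two symmetric solutions of the ARE, the first of which is strong, is positive
semidefinite. -/
theorem StrongSolution.sub_posSemidef {n p : ℕ}
    {A : Matrix (Fin n) (Fin n) ℝ} {B : Matrix (Fin n) (Fin p) ℝ}
    {Q : Matrix (Fin n) (Fin n) ℝ} {R : Matrix (Fin p) (Fin p) ℝ} (hR : R.PosDef)
    (hstab : Stabilizable A B) {Xs X : Matrix (Fin n) (Fin n) ℝ}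
    (hs : StrongSolution A B Q R Xs) (hX : Xᵀ = X) (hXsol : SolvesARE A B Q R X) :
    (Xs - X).PosSemidef := by
  obtain ⟨hXs, hXssol, heig⟩ := hs
  obtain ⟨C, hC⟩ : ∃ C : Matrix (Fin p) (Fin p) ℝ, R⁻¹ = Cᵀ * C := by
    open scoped MatrixOrder in
    exact CStarAlgebra.nonneg_iff_eq_star_mul_self.mp hR.inv.posSemidef.nonneg
  have hRC : R * (Cᵀ * C) = 1 := by
    rw [← hC]
    exact Matrix.mul_nonsing_inv R ((Matrix.isUnit_iff_isUnit_det R).1 hR.isUnit)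
  unfold SolvesARE at hXsol hXssol
  rw [hC] at hXsol hXssol heig
  refine Matrix.posSemidef_of_lyapunov (M := A - B * (Cᵀ * C) * Bᵀ * Xs)
    (L := C * Bᵀ * (Xs - X)) (B := B) (E := R * Cᵀ) (by simp [hX, hXs]) ?_ ?_ heig ?_
  · have key := congrArg₂ (· - ·) hXsol hXssol
    simp only [sub_self] at key
    rw [← sub_eq_zero, ← key]
    simp only [Matrix.transpose_sub, Matrix.transpose_mul, Matrix.transpose_transpose, hX, hXs,
      Matrix.mul_sub, Matrix.sub_mul, Matrix.mul_assoc]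
    abel
  · calc Bᵀ * (Xs - X) = R * (Cᵀ * C) * (Bᵀ * (Xs - X)) := by rw [hRC, Matrix.one_mul]
      _ = R * Cᵀ * (C * Bᵀ * (Xs - X)) := by simp only [Matrix.mul_assoc]
  · obtain ⟨F, hF⟩ := hstab
    refine ⟨F + Cᵀ * C * Bᵀ * Xs, ?_⟩
    have : A - B * (Cᵀ * C) * Bᵀ * Xs + B * (F + Cᵀ * C * Bᵀ * Xs) = A + B * F := by
      simp only [Matrix.mul_add, Matrix.mul_assoc]
      abel
    rwa [this]

/-- If `(A, B)` is stabilizable then (i) any strong solution of the ARE is maximal in the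
Loewner order among symmetric solutions, and (ii) there is at most one strong solution. -/
theorem strong_solution_maximal_and_unique (n p : ℕ)
    (A : Matrix (Fin n) (Fin n) ℝ) (B : Matrix (Fin n) (Fin p) ℝ)
    (Q : Matrix (Fin n) (Fin n) ℝ) (hQ : Q.PosSemidef)
    (R : Matrix (Fin p) (Fin p) ℝ) (hR : R.PosDef)
    (hstab : Stabilizable A B) :
    (∀ Xs : Matrix (Fin n) (Fin n) ℝ, StrongSolution A B Q R Xs →
      ∀ X : Matrix (Fin n) (Fin n) ℝ, Xᵀ = X → SolvesARE A B Q R X →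
        (Xs - X).PosSemidef) ∧
    (∀ X₁ X₂ : Matrix (Fin n) (Fin n) ℝ,
      StrongSolution A B Q R X₁ → StrongSolution A B Q R X₂ → X₁ = X₂) := by
  refine ⟨fun Xs hs X hX hsol => hs.sub_posSemidef hR hstab hX hsol, fun X₁ X₂ h₁ h₂ => ?_⟩
  open scoped MatrixOrder in
  exact le_antisymm (Matrix.le_iff.2 (h₂.sub_posSemidef hR hstab h₁.1 h₁.2.1))
    (Matrix.le_iff.2 (h₁.sub_posSemidef hR hstab h₂.1 h₂.2.1))
end
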